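/- Let 0 < α < 1, ε > 0, γ_α = 2 sin(πα)/π, let μ_1, …, μ_L be positive reals and let the nodes satisfy 0 < θ_1 < θ_2 < ⋯ < θ_L. Let S be the real (L+1)×(L+1) matrix with entries S_{0,0} = 0, S_{0,ℓ} = −ε μ_ℓ for ℓ = 1, …, L, S_{j,0} = 0 for j = 1, …, L, and S_{j,ℓ} = −(δ_{jℓ} θ_j² + ε γ_α θ_j^{2α−1} μ_ℓ) for j, ℓ = 1, …, L. Then the spectral radius of S is strictly greater than θ_L², i.e. S has an eigenvalue λ with |λ| > θ_L². -/

import Mathlib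

open Matrix

/-- The secular equation `∑ i, w i / (x - d i) = 1` with positive weights has a solution to the
right of any upper bound `d k` of the poles that is itself a pole. -/
theorem exists_secular_root {ι : Type*} [Fintype ι] (w d : ι → ℝ) (hw : ∀ i, 0 < w i)
    (k : ι) (hd : ∀ i, d i ≤ d k) :
    ∃ x, d k < x ∧ ∑ i, w i / (x - d i) = 1 := by
  have hk : w k ≤ ∑ i, w i :=
    Finset.single_le_sum (fun i _ => (hw i).le) (Finset.mem_univ k)
  have hwk := hw k
  have hcont : ContinuousOn (fun x => ∑ i, w i / (x - d i))
      (Set.Icc (d k + w k) (d k + ∑ i, w i)) := by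
    refine continuousOn_finsetSum _ fun i _ => ?_
    refine continuousOn_const.div (by fun_prop) fun x hx => ?_
    have := hd i
    linarith [hx.1]
  have hleft : 1 ≤ ∑ i, w i / (d k + w k - d i) := by
    calc (1 : ℝ) = w k / (d k + w k - d k) := by
          rw [add_sub_cancel_left, div_self hwk.ne']
      _ ≤ _ := Finset.single_le_sum (f := fun i => w i / (d k + w k - d i))
          (fun i _ => div_nonneg (hw i).le (by linarith [hd i])) (Finset.mem_univ k)
  have hright : ∑ i, w i / (d k + ∑ j, w j - d i) ≤ 1 := by
    calc ∑ i, w i / (d k + ∑ j, w j - d i) ≤ ∑ i, w i / ∑ j, w j := by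
          refine Finset.sum_le_sum fun i _ => ?_
          exact div_le_div_of_nonneg_left (hw i).le (by linarith) (by linarith [hd i])
      _ = 1 := by rw [← Finset.sum_div, div_self (by linarith)]
  obtain ⟨x, hx, hroot⟩ := intermediate_value_Icc' (by linarith) hcont ⟨hright, hleft⟩
  exact ⟨x, by linarith [hx.1], hroot⟩

theorem Matrix.mem_spectrum_of_mulVec_eq_smul {n K : Type*} [Fintype n] [DecidableEq n] [Field K]
    {A : Matrix n n K} {c : K} {v : n → K} (hv : v ≠ 0) (h : A *ᵥ v = c • v) :
    c ∈ spectrum K A := by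
  rw [← Matrix.spectrum_toLin']
  refine (Module.End.hasEigenvalue_of_hasEigenvector (x := v) ?_).mem_spectrum
  exact ⟨Module.End.mem_eigenspace_iff.mpr (by rw [Matrix.toLin'_apply, h]), hv⟩

/-- Lower bound on the spectral radius of the relaxation matrix `S` of the diffusive
approximation, with positive weights and increasing nodes `0 < θ_1 < … < θ_L`:
`S` has an eigenvalue `λ` with `|λ| > θ_L²`. -/
theorem relaxation_matrix_spectral_radius (α γα ε : ℝ) (L : ℕ) (hL : 0 < L)
    (hα0 : 0 < α) (hα1 : α < 1)
    (hγ : γα = 2 * Real.sin (Real.pi * α) / Real.pi) (hε : 0 < ε)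
    (μ θ : Fin L → ℝ) (hμ : ∀ ℓ, 0 < μ ℓ) (hθ0 : ∀ ℓ, 0 < θ ℓ) (hθmono : StrictMono θ)
    (S : Matrix (Fin (L + 1)) (Fin (L + 1)) ℝ)
    (hS : S = Matrix.of (Fin.cons
      (Fin.cons 0 (fun ℓ : Fin L => -(ε * μ ℓ)))
      (fun j : Fin L => Fin.cons 0 (fun ℓ : Fin L =>
        -((if j = ℓ then θ j ^ 2 else 0) + ε * γα * θ j ^ (2 * α - 1) * μ ℓ))))) :
    ∃ lam : ℝ, lam ∈ spectrum ℝ S ∧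
      θ ⟨L - 1, Nat.sub_lt hL Nat.one_pos⟩ ^ 2 < |lam| := by
  set k : Fin L := ⟨L - 1, Nat.sub_lt hL Nat.one_pos⟩
  have hγ0 : 0 < γα := by
    rw [hγ]
    have := Real.sin_pos_of_pos_of_lt_pi (mul_pos Real.pi_pos hα0)
      (by nlinarith [Real.pi_pos])
    positivity
  set c : Fin L → ℝ := fun j => ε * γα * θ j ^ (2 * α - 1)
  have hc : ∀ j, 0 < c j := fun j =>
    mul_pos (mul_pos hε hγ0) (Real.rpow_pos_of_pos (hθ0 j) _)
  have hθk : ∀ j, θ j ^ 2 ≤ θ k ^ 2 := fun j =>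
    pow_le_pow_left₀ (hθ0 j).le (hθmono.monotone (Fin.le_def.mpr (Nat.le_sub_one_of_lt j.2))) 2
  obtain ⟨x, hx, hroot⟩ := exists_secular_root (fun j => c j * μ j) (fun j => θ j ^ 2)
    (fun j => mul_pos (hc j) (hμ j)) k hθk
  have hx0 : 0 < x := (sq_nonneg _).trans_lt hx
  set v : Fin L → ℝ := fun j => c j / (x - θ j ^ 2) with hv
  have hsum : ∑ j, μ j * v j = 1 := by
    rw [← hroot]
    exact Finset.sum_congr rfl fun j _ => by simp only [hv]; ring
  refine ⟨-x, Matrix.mem_spectrum_of_mulVec_eq_smul (v := Fin.cons (ε / x) v) ?_ ?_, ?_⟩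
  · intro h
    exact (div_pos hε hx0).ne' (congrFun h 0)
  · ext i
    rw [hS]
    refine Fin.cases ?_ (fun j => ?_) i
    · simp only [mulVec, dotProduct, Fin.sum_univ_succ, of_apply, Fin.cons_zero, Fin.cons_succ,
        Pi.smul_apply, smul_eq_mul, neg_mul, mul_assoc, Finset.sum_neg_distrib, ← Finset.mul_sum,
        hsum]
      field_simp
      ring
    · have hne : x - θ j ^ 2 ≠ 0 := by linarith [hθk j]
      have hvj : (x - θ j ^ 2) * v j = c j := mul_div_cancel₀ _ hne
      have hrow : ∑ ℓ, -((if j = ℓ then θ j ^ 2 else 0) + c j * μ ℓ) * v ℓ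
          = -(θ j ^ 2 * v j + c j) := by
        simp only [neg_mul, add_mul, ite_mul, zero_mul, mul_assoc, Finset.sum_neg_distrib,
          Finset.sum_add_distrib, Finset.sum_ite_eq, Finset.mem_univ, if_true, ← Finset.mul_sum,
          hsum, mul_one]
      simp only [mulVec, dotProduct, Fin.sum_univ_succ, of_apply, Fin.cons_zero, Fin.cons_succ,
        Pi.smul_apply, smul_eq_mul, zero_mul, zero_add]
      exact hrow.trans (by linear_combination hvj)
  · rwa [abs_neg, abs_of_pos hx0]
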